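/- For every multi-index q ∈ ℕ⁴ there exists a constant C such that ∫_{ℝ×ℝ³} |D^q(K*ρ_ε)(z)|² dz ≤ C·ε^{−1−2|q|} for all ε ∈ (0,1). (For ξ_ε = ρ_ε * ξ a mollified space-time white noise, this is the bound E|D^q(K*ξ_ε)(z)|² ≲ ε^{−1−2|q|}.) -/

import Mathlib

open MeasureTheory

/-- The parabolic norm on space-time `ℝ×ℝ³` (coordinates `z 0 = t`, `z 1, z 2, z 3 = x`):
`‖z‖ = |t|^{1/2} + |x|`. -/
noncomputable def pnorm (z : Fin 4 → ℝ) : ℝ :=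
  Real.sqrt |z 0| + Real.sqrt ((z 1) ^ 2 + (z 2) ^ 2 + (z 3) ^ 2)

/-- The parabolic degree `|ℓ| = 2ℓ₀ + ℓ₁ + ℓ₂ + ℓ₃` of a multi-index. -/
def pdeg (l : Fin 4 → ℕ) : ℕ := 2 * l 0 + l 1 + l 2 + l 3

/-- Partial derivative in the `i`-th coordinate direction. -/
noncomputable def pd (i : Fin 4) (f : (Fin 4 → ℝ) → ℝ) : (Fin 4 → ℝ) → ℝ :=
  fun z => fderiv ℝ f z (Pi.single i 1)

/-- The multi-index derivative `D^ℓ = ∂_t^{ℓ₀}∂_{x₁}^{ℓ₁}∂_{x₂}^{ℓ₂}∂_{x₃}^{ℓ₃}`. -/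
noncomputable def Dmulti (l : Fin 4 → ℕ) (f : (Fin 4 → ℝ) → ℝ) : (Fin 4 → ℝ) → ℝ :=
  (pd 0)^[l 0] ((pd 1)^[l 1] ((pd 2)^[l 2] ((pd 3)^[l 3] f)))

/-- The parabolic rescaling `φ_ε(t,x) = ε⁻⁵ φ(t/ε², x/ε)`. -/
noncomputable def parRescale (ε : ℝ) (φ : (Fin 4 → ℝ) → ℝ) : (Fin 4 → ℝ) → ℝ :=
  fun z => (ε ^ 5)⁻¹ * φ (fun i => if i = 0 then z 0 / ε ^ 2 else z i / ε)

/-- Space-time convolution `(f*g)(z) = ∫ f(z−w)g(w) dw`. -/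
noncomputable def stConv (f g : (Fin 4 → ℝ) → ℝ) : (Fin 4 → ℝ) → ℝ :=
  fun z => ∫ w : Fin 4 → ℝ, f (z - w) * g w

open scoped ContDiff

lemma pd_smul (i : Fin 4) (c : ℝ) (f : (Fin 4 → ℝ) → ℝ) : pd i (c • f) = c • pd i f := by
  funext z
  simp [pd, fderiv_const_smul_field]

/-- Smooth functions of compact support on space-time. -/
def IsTestFun (f : (Fin 4 → ℝ) → ℝ) : Prop := ContDiff ℝ ∞ f ∧ HasCompactSupport f

namespace IsTestFun
variable {f : (Fin 4 → ℝ) → ℝ}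

lemma pd (hf : IsTestFun f) (i : Fin 4) : IsTestFun (pd i f) :=
  ⟨(hf.1.fderiv_right (m := ∞) (by simp)).clm_apply contDiff_const,
    hf.2.fderiv_apply (𝕜 := ℝ) _⟩

lemma pd_iterate (hf : IsTestFun f) (i : Fin 4) (n : ℕ) : IsTestFun ((_root_.pd i)^[n] f) := by
  induction n with
  | zero => exact hf
  | succ n ih => rw [Function.iterate_succ_apply']; exact ih.pd i

lemma dmulti (hf : IsTestFun f) (q : Fin 4 → ℕ) : IsTestFun (Dmulti q f) :=
  (((hf.pd_iterate 3 _).pd_iterate 2 _).pd_iterate 1 _).pd_iterate 0 _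

end IsTestFun

lemma stConv_eq_convolution (K g : (Fin 4 → ℝ) → ℝ) :
    stConv K g = convolution g K (ContinuousLinearMap.mul ℝ ℝ) volume := by
  funext z
  simp [stConv, convolution_def, mul_comm]

lemma pd_stConv {K g : (Fin 4 → ℝ) → ℝ} (hK : LocallyIntegrable K) (hg : IsTestFun g)
    (i : Fin 4) : pd i (stConv K g) = stConv K (pd i g) := by
  funext z
  have hex := (hg.2.fderiv ℝ).convolutionExists_left
    ((ContinuousLinearMap.mul ℝ ℝ).precompL (Fin 4 → ℝ)) (hg.1.continuous_fderiv (by simp)) hK z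
  rw [pd, stConv_eq_convolution, stConv_eq_convolution, (hg.2.hasFDerivAt_convolution_left
    (ContinuousLinearMap.mul ℝ ℝ) (hg.1.of_le (by simp)) hK z).fderiv, convolution_def,
    ContinuousLinearMap.integral_apply hex]
  rfl

lemma pd_iterate_stConv {K g : (Fin 4 → ℝ) → ℝ} (hK : LocallyIntegrable K) (hg : IsTestFun g)
    (i : Fin 4) (n : ℕ) : (pd i)^[n] (stConv K g) = stConv K ((pd i)^[n] g) := by
  induction n with
  | zero => rfl
  | succ n ih =>
    rw [Function.iterate_succ_apply', ih, pd_stConv hK (hg.pd_iterate i n),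
      Function.iterate_succ_apply']

lemma dmulti_stConv {K g : (Fin 4 → ℝ) → ℝ} (hK : LocallyIntegrable K) (hg : IsTestFun g)
    (q : Fin 4 → ℕ) : Dmulti q (stConv K g) = stConv K (Dmulti q g) := by
  have h3 := hg.pd_iterate 3 (q 3)
  have h2 := h3.pd_iterate 2 (q 2)
  have h1 := h2.pd_iterate 1 (q 1)
  rw [Dmulti, pd_iterate_stConv hK hg, pd_iterate_stConv hK h3, pd_iterate_stConv hK h2,
    pd_iterate_stConv hK h1, Dmulti]

/-- The parabolic scaling factors: `ε ^ 2` in time and `ε` in space. -/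
def parScale (ε : ℝ) (i : Fin 4) : ℝ := if i = 0 then ε ^ 2 else ε

lemma parScale_pos {ε : ℝ} (hε : 0 < ε) (i : Fin 4) : 0 < parScale ε i := by
  unfold parScale; split_ifs <;> positivity

/-- The linear dilation `(t, x) ↦ (t / ε ^ 2, x / ε)`. -/
noncomputable def parDilate (ε : ℝ) : (Fin 4 → ℝ) →L[ℝ] (Fin 4 → ℝ) :=
  ContinuousLinearMap.pi fun i => (parScale ε i)⁻¹ • ContinuousLinearMap.proj i

lemma parDilate_apply (ε : ℝ) (z : Fin 4 → ℝ) (i : Fin 4) :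
    parDilate ε z i = z i / parScale ε i := by
  simp [parDilate, div_eq_inv_mul]

lemma parDilate_single (ε : ℝ) (i : Fin 4) :
    parDilate ε (Pi.single i 1) = (parScale ε i)⁻¹ • Pi.single i 1 := by
  funext j
  rw [parDilate_apply]
  rcases eq_or_ne j i with rfl | h
  · simp
  · simp [h]

lemma parRescale_eq (ε : ℝ) (φ : (Fin 4 → ℝ) → ℝ) :
    parRescale ε φ = (ε ^ 5)⁻¹ • (φ ∘ parDilate ε) := by
  funext z
  simp only [parRescale, Pi.smul_apply, Function.comp_apply, smul_eq_mul]
  congr 2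
  funext i
  rw [parDilate_apply, parScale]
  split_ifs with h
  · rw [h]
  · rfl

lemma IsTestFun.parRescale {φ : (Fin 4 → ℝ) → ℝ} (hφ : IsTestFun φ) {ε : ℝ} (hε : 0 < ε) :
    IsTestFun (parRescale ε φ) := by
  rw [parRescale_eq]
  refine ⟨by exact (hφ.1.comp (parDilate ε).contDiff).const_smul ((ε ^ 5)⁻¹), ?_⟩
  let e : (Fin 4 → ℝ) ≃ₜ (Fin 4 → ℝ) := Homeomorph.piCongrRight fun i =>
    Homeomorph.mulRight₀ (parScale ε i)⁻¹ (inv_pos.2 (parScale_pos hε i)).ne'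
  have : (⇑(parDilate ε) : (Fin 4 → ℝ) → Fin 4 → ℝ) = e := by
    funext z i
    rw [parDilate_apply, div_eq_mul_inv]
    rfl
  rw [this]
  exact (hφ.2.comp_homeomorph e).smul_left (f := fun _ => (ε ^ 5)⁻¹)

lemma pd_parRescale {φ : (Fin 4 → ℝ) → ℝ} (hφ : IsTestFun φ) (ε : ℝ) (i : Fin 4) :
    pd i (parRescale ε φ) = (parScale ε i)⁻¹ • parRescale ε (pd i φ) := by
  rw [parRescale_eq, parRescale_eq, pd_smul, smul_comm]
  congr 1
  funext z
  have h : HasFDerivAt (φ ∘ parDilate ε) ((fderiv ℝ φ (parDilate ε z)).comp (parDilate ε)) z :=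
    ((hφ.1.differentiable (by simp)) _).hasFDerivAt.comp z (parDilate ε).hasFDerivAt
  simp only [pd, h.fderiv, ContinuousLinearMap.comp_apply, parDilate_single, map_smul,
    Pi.smul_apply, Function.comp_apply]

lemma pd_iterate_smul_parRescale {φ : (Fin 4 → ℝ) → ℝ} (hφ : IsTestFun φ) (c ε : ℝ) (i : Fin 4)
    (n : ℕ) : (pd i)^[n] (c • parRescale ε φ) =
      (c * (parScale ε i ^ n)⁻¹) • parRescale ε ((pd i)^[n] φ) := by
  induction n with
  | zero => simp
  | succ n ih =>
    rw [Function.iterate_succ_apply', ih, pd_smul, pd_parRescale (hφ.pd_iterate i n), smul_smul,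
      Function.iterate_succ_apply', pow_succ, mul_inv, mul_assoc]

lemma dmulti_parRescale {φ : (Fin 4 → ℝ) → ℝ} (hφ : IsTestFun φ) (ε : ℝ) (q : Fin 4 → ℕ) :
    Dmulti q (parRescale ε φ) = (ε ^ pdeg q)⁻¹ • parRescale ε (Dmulti q φ) := by
  have h3 := hφ.pd_iterate 3 (q 3)
  have h2 := h3.pd_iterate 2 (q 2)
  have h1 := h2.pd_iterate 1 (q 1)
  rw [Dmulti, ← one_smul ℝ (parRescale ε φ), pd_iterate_smul_parRescale hφ,
    pd_iterate_smul_parRescale h3, pd_iterate_smul_parRescale h2, pd_iterate_smul_parRescale h1,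
    Dmulti]
  congr 1
  simp only [parScale, pdeg, ← mul_inv, one_mul]
  congr 1
  simp
  ring

/-- Tonelli's theorem for a product of functions of one coordinate each. -/
lemma lintegral_fin_prod {n : ℕ} (f : Fin n → ℝ → ENNReal) (hf : ∀ i, Measurable (f i)) :
    ∫⁻ z : Fin n → ℝ, ∏ i, f i (z i) = ∏ i, ∫⁻ s, f i s := by
  induction n with
  | zero => simp [volume_pi]
  | succ n ih =>
    rw [← (volume_preserving_piFinSuccAbove (fun _ : Fin (n + 1) => ℝ) 0).symm.lintegral_comp_emb
      (MeasurableEquiv.measurableEmbedding _)]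
    simp only [Fin.prod_univ_succ, MeasurableEquiv.piFinSuccAbove_symm_apply,
      Fin.insertNthEquiv_apply, Fin.insertNth_zero', Fin.cons_zero, Fin.cons_succ]
    rw [← ih _ fun i => hf i.succ, Measure.volume_eq_prod]
    exact lintegral_prod_mul (g := fun z : Fin n → ℝ => ∏ i : Fin n, f i.succ (z i))
      (hf 0).aemeasurable (Finset.univ.measurable_prod fun i _ =>
        (hf i.succ).comp (measurable_pi_apply i)).aemeasurable

/-- The singular weight `|s| ^ (-3/5)`, with value `∞` at the origin. The product of four of them
dominates `‖z‖ ^ (-3)` on space-time. -/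
noncomputable def singWeight (s : ℝ) : ENNReal := ENNReal.ofReal |s| ^ (-(3 / 5) : ℝ)

lemma measurable_singWeight : Measurable singWeight := by unfold singWeight; fun_prop

lemma singWeight_mul {r : ℝ} (hr : 0 < r) (s : ℝ) :
    singWeight (r * s) = ENNReal.ofReal (r ^ (-(3 / 5) : ℝ)) * singWeight s := by
  rw [singWeight, singWeight, abs_mul, ENNReal.ofReal_mul (abs_nonneg _), abs_of_pos hr,
    ENNReal.mul_rpow_of_ne_top ENNReal.ofReal_ne_top ENNReal.ofReal_ne_top,
    ENNReal.ofReal_rpow_of_pos hr]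

lemma singWeight_anti {s t : ℝ} (h : |s| ≤ |t|) : singWeight t ≤ singWeight s := by
  unfold singWeight
  rw [ENNReal.rpow_neg, ENNReal.rpow_neg, ENNReal.inv_le_inv]
  gcongr

lemma lintegral_singWeight_lt_top (a : ℝ) :
    ∫⁻ s, (Set.Icc (-a) a).indicator singWeight s < ⊤ := by
  set u : ℝ → ENNReal := (Set.Ioc 0 a).indicator singWeight with hu
  have hum : Measurable u := measurable_singWeight.indicator measurableSet_Ioc
  have h1 : ∫⁻ s, u s < ⊤ := by
    rw [hu, lintegral_indicator measurableSet_Ioc]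
    rcases le_or_gt a 0 with ha | ha
    · simp [Set.Ioc_eq_empty_of_le ha]
    have h := (intervalIntegral.intervalIntegrable_rpow' (a := 0) (b := a)
      (r := -(3 / 5)) (by norm_num)).1
    have h2 := h.2
    refine lt_of_le_of_lt (le_of_eq ?_) h2
    refine setLIntegral_congr_fun measurableSet_Ioc fun s hs => ?_
    simp only [singWeight]
    rw [abs_of_pos hs.1, ENNReal.ofReal_rpow_of_pos hs.1,
      Real.enorm_of_nonneg (Real.rpow_nonneg hs.1.le _)]
  calc ∫⁻ s, (Set.Icc (-a) a).indicator singWeight s ≤ ∫⁻ s, (u s + u (-s)) := by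
        refine lintegral_mono_ae ?_
        filter_upwards [Measure.ae_ne volume (0 : ℝ)] with s hs
        by_cases hm : s ∈ Set.Icc (-a) a
        swap
        · simp [hm]
        rw [Set.indicator_of_mem hm]
        rcases lt_or_gt_of_ne hs with h | h
        · have : -s ∈ Set.Ioc 0 a := ⟨by linarith, by linarith [hm.1]⟩
          simp [hu, this, singWeight]
        · have : s ∈ Set.Ioc 0 a := ⟨h, hm.2⟩
          simp [hu, this]
    _ = (∫⁻ s, u s) + ∫⁻ s, u s := by
        rw [lintegral_add_left hum, lintegral_neg_eq_self]
    _ < ⊤ := ENNReal.add_lt_top.2 ⟨h1, h1⟩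

lemma measurable_boxWeight_integrand (r s : ℝ) : Measurable fun u =>
    singWeight (s - u) * (Set.Icc (-r) r).indicator 1 u :=
  (measurable_singWeight.comp (by fun_prop)).mul (measurable_one.indicator measurableSet_Icc)

/-- The convolution of `singWeight` with the indicator function of `[-r, r]`. -/
noncomputable def boxWeight (r s : ℝ) : ENNReal :=
  ∫⁻ u, singWeight (s - u) * (Set.Icc (-r) r).indicator 1 u

lemma measurable_boxWeight (r : ℝ) : Measurable (boxWeight r) := by
  refine Measurable.lintegral_prod_right'
    (f := fun p : ℝ × ℝ => singWeight (p.1 - p.2) * (Set.Icc (-r) r).indicator 1 p.2) ?_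
  exact (measurable_singWeight.comp (by fun_prop)).mul
    ((measurable_one.indicator measurableSet_Icc).comp measurable_snd)

lemma lintegral_scale {r : ℝ} (hr : 0 < r) (f : ℝ → ENNReal) (hf : Measurable f) :
    ∫⁻ s, f s = ENNReal.ofReal r * ∫⁻ s, f (r * s) := by
  conv_lhs => rw [← Real.smul_map_volume_mul_left hr.ne', lintegral_smul_measure,
    lintegral_map hf (by fun_prop), abs_of_pos hr]
  rfl

lemma boxWeight_scale {r : ℝ} (hr : 0 < r) (s : ℝ) :
    boxWeight r (r * s) = ENNReal.ofReal (r ^ (2 / 5 : ℝ)) * boxWeight 1 s := by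
  unfold boxWeight
  rw [lintegral_scale hr _ (measurable_boxWeight_integrand r (r * s))]
  have h (u : ℝ) : singWeight (r * s - r * u) * (Set.Icc (-r) r).indicator 1 (r * u)
      = ENNReal.ofReal (r ^ (-(3 / 5) : ℝ)) *
        (singWeight (s - u) * (Set.Icc (-1) 1).indicator 1 u) := by
    rw [← mul_sub, singWeight_mul hr, mul_assoc]
    congr 2
    have : r * u ∈ Set.Icc (-r) r ↔ u ∈ Set.Icc (-1 : ℝ) 1 := by
      constructor <;> rintro ⟨h1, h2⟩ <;> constructor <;> nlinarith
    simp only [Set.indicator_apply, this, Pi.one_apply]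
  simp_rw [h]
  rw [lintegral_const_mul _ (measurable_boxWeight_integrand 1 s), ← mul_assoc, ← ENNReal.ofReal_mul hr.le]
  congr 2
  rw [← Real.rpow_one_add' hr.le (by norm_num)]
  norm_num

lemma lintegral_boxWeight_sq {r : ℝ} (hr : 0 < r) :
    ∫⁻ s, boxWeight r s ^ 2 = ENNReal.ofReal (r ^ (9 / 5 : ℝ)) * ∫⁻ s, boxWeight 1 s ^ 2 := by
  rw [lintegral_scale hr _ ((measurable_boxWeight r).pow_const 2)]
  simp_rw [boxWeight_scale hr, mul_pow]
  rw [lintegral_const_mul _ ((measurable_boxWeight 1).pow_const 2), ← mul_assoc,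
    ← ENNReal.ofReal_pow (by positivity), ← ENNReal.ofReal_mul hr.le]
  congr 2
  rw [← Real.rpow_natCast, ← Real.rpow_mul hr.le, ← Real.rpow_one_add' hr.le (by norm_num)]
  norm_num

lemma lintegral_boxWeight_one_sq_lt_top : ∫⁻ s, boxWeight 1 s ^ 2 < ⊤ := by
  obtain ⟨c, hc, hbound⟩ : ∃ c : ENNReal, c ≠ ⊤ ∧ ∀ s, boxWeight 1 s ≤ c * singWeight (1 + |s|) := by
    have hJ := (lintegral_singWeight_lt_top 3).ne
    set J := ∫⁻ s, (Set.Icc (-3) 3).indicator singWeight s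
    have h3 : ENNReal.ofReal ((3⁻¹ : ℝ) ^ (-(3 / 5) : ℝ)) ≠ ⊤ := ENNReal.ofReal_ne_top
    set b := ENNReal.ofReal ((3⁻¹ : ℝ) ^ (-(3 / 5) : ℝ)) with hb
    have hmul (s : ℝ) : b * singWeight s = singWeight (3⁻¹ * s) := (singWeight_mul (by norm_num) s).symm
    refine ⟨J * b + b * 2, by finiteness, fun s => ?_⟩
    rcases le_or_gt |s| 2 with hs | hs
    · calc boxWeight 1 s ≤ ∫⁻ u, (Set.Icc (-3) 3).indicator singWeight (s - u) := by
            refine lintegral_mono fun u => ?_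
            by_cases hu : u ∈ Set.Icc (-1 : ℝ) 1
            · have : s - u ∈ Set.Icc (-3 : ℝ) 3 := by
                rw [abs_le] at hs
                constructor <;> linarith [hu.1, hu.2]
              simp [hu, this]
            · simp [hu]
        _ = J := lintegral_sub_left_eq_self _ s
        _ ≤ J * (b * singWeight (1 + |s|)) := by
            refine le_mul_of_one_le_right' ?_
            rw [hmul]
            calc 1 = singWeight 1 := by simp [singWeight]
              _ ≤ _ := singWeight_anti (by
                rw [abs_of_nonneg (by positivity), abs_one]; linarith)
        _ ≤ _ := by rw [← mul_assoc, add_mul]; exact le_self_add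
    · calc boxWeight 1 s ≤ ∫⁻ u, b * singWeight (1 + |s|) * (Set.Icc (-1 : ℝ) 1).indicator 1 u := by
            refine lintegral_mono fun u => ?_
            by_cases hu : u ∈ Set.Icc (-1 : ℝ) 1
            · simp only [hu, Set.indicator_of_mem, Pi.one_apply, mul_one, hmul]
              refine singWeight_anti ?_
              have : |u| ≤ 1 := abs_le.2 hu
              rw [abs_of_nonneg (by positivity)]
              linarith [abs_sub_abs_le_abs_sub s u]
            · simp [hu]
        _ = b * singWeight (1 + |s|) * 2 := by
            rw [lintegral_const_mul _ (measurable_one.indicator measurableSet_Icc),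
              lintegral_indicator_one measurableSet_Icc, Real.volume_Icc]
            norm_num
        _ ≤ _ := by
            rw [mul_right_comm, add_mul]; exact le_add_self
  calc ∫⁻ s, boxWeight 1 s ^ 2 ≤ ∫⁻ s, c ^ 2 * ENNReal.ofReal ((1 + ‖s‖) ^ (-(6 / 5) : ℝ)) := by
        refine lintegral_mono fun s => ?_
        refine (pow_le_pow_left' (hbound s) 2).trans (le_of_eq ?_)
        have hp : 0 < 1 + |s| := by positivity
        rw [mul_pow, singWeight, abs_of_pos hp, ← ENNReal.rpow_natCast, ← ENNReal.rpow_natCast,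
          ← ENNReal.rpow_mul, ENNReal.ofReal_rpow_of_pos hp, Real.norm_eq_abs]
        norm_num
    _ = c ^ 2 * ∫⁻ s, ENNReal.ofReal ((1 + ‖s‖) ^ (-(6 / 5) : ℝ)) :=
        lintegral_const_mul _ (by fun_prop)
    _ < ⊤ := ENNReal.mul_lt_top (by finiteness)
        (finite_integral_one_add_norm (by simp; norm_num))

lemma pnorm_nonneg (z : Fin 4 → ℝ) : 0 ≤ pnorm z := by unfold pnorm; positivity

lemma abs_le_pnorm (z : Fin 4 → ℝ) {i : Fin 4} (hi : i ≠ 0) : |z i| ≤ pnorm z := by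
  have h : |z i| ≤ Real.sqrt ((z 1) ^ 2 + (z 2) ^ 2 + (z 3) ^ 2) := by
    refine Real.abs_le_sqrt ?_
    fin_cases i
    · exact absurd rfl hi
    all_goals
      simp only [Fin.reduceFinMk, Fin.mk_one]
      nlinarith [sq_nonneg (z 1), sq_nonneg (z 2), sq_nonneg (z 3)]
  exact h.trans (le_add_of_nonneg_left (Real.sqrt_nonneg _))

lemma abs_zero_le_pnorm_sq (z : Fin 4 → ℝ) : |z 0| ≤ pnorm z ^ 2 := by
  rw [← Real.sqrt_le_left (pnorm_nonneg z)]
  exact le_add_of_nonneg_right (Real.sqrt_nonneg _)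

lemma pnorm_pos {z : Fin 4 → ℝ} (hz : z ≠ 0) : 0 < pnorm z := by
  refine (pnorm_nonneg z).lt_of_ne fun h => hz ?_
  funext i
  rcases eq_or_ne i 0 with rfl | hi
  · have := abs_zero_le_pnorm_sq z
    rw [← h] at this
    simpa using this
  · have := abs_le_pnorm z hi
    rw [← h] at this
    simpa using this

lemma ofReal_pnorm_rpow_le_prod {z : Fin 4 → ℝ} (hz : z ≠ 0) :
    ENNReal.ofReal (pnorm z ^ (-3 : ℝ)) ≤ ∏ i, singWeight (z i) := by
  have hp := pnorm_pos hz
  have h0 : singWeight (pnorm z ^ 2) ≤ singWeight (z 0) :=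
    singWeight_anti ((abs_zero_le_pnorm_sq z).trans (le_abs_self _))
  have hi (i : Fin 4) (hi : i ≠ 0) : singWeight (pnorm z) ≤ singWeight (z i) :=
    singWeight_anti ((abs_le_pnorm z hi).trans (le_abs_self _))
  calc ENNReal.ofReal (pnorm z ^ (-3 : ℝ))
      = singWeight (pnorm z ^ 2) * singWeight (pnorm z) * singWeight (pnorm z) *
          singWeight (pnorm z) := by
        simp only [singWeight, abs_of_pos hp, abs_of_pos (pow_pos hp 2)]
        rw [ENNReal.ofReal_rpow_of_pos hp, ENNReal.ofReal_rpow_of_pos (pow_pos hp 2),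
          ← ENNReal.ofReal_mul (by positivity), ← ENNReal.ofReal_mul (by positivity),
          ← ENNReal.ofReal_mul (by positivity), ← Real.rpow_natCast, ← Real.rpow_mul hp.le,
          ← Real.rpow_add hp, ← Real.rpow_add hp, ← Real.rpow_add hp]
        norm_num
    _ ≤ ∏ i, singWeight (z i) := by
        rw [Fin.prod_univ_four]
        gcongr
        exacts [hi 1 (by decide), hi 2 (by decide), hi 3 (by decide)]

lemma enorm_kernel_le {K : (Fin 4 → ℝ) → ℝ} {C : ℝ} (hK_supp : ∀ z, 1 < pnorm z → K z = 0)
    (hK : ∀ z, z ≠ 0 → |K z| ≤ C * pnorm z ^ (-3 : ℝ)) (z : Fin 4 → ℝ) :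
    ‖K z‖ₑ ≤ ENNReal.ofReal (|C| + 1) * ∏ i, (Set.Icc (-1) 1).indicator singWeight (z i) := by
  rcases eq_or_ne z 0 with rfl | hz
  · have : ENNReal.ofReal (|C| + 1) ≠ 0 := by simp; positivity
    simp [singWeight, this]
  rcases lt_or_ge 1 (pnorm z) with h1 | h1
  · simp [hK_supp z h1]
  have hmem (i : Fin 4) : z i ∈ Set.Icc (-1 : ℝ) 1 := by
    refine abs_le.1 ?_
    rcases eq_or_ne i 0 with rfl | hi
    · exact (abs_zero_le_pnorm_sq z).trans (pow_le_one₀ (pnorm_nonneg z) h1)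
    · exact (abs_le_pnorm z hi).trans h1
  simp only [Set.indicator_of_mem (hmem _)]
  calc ‖K z‖ₑ = ENNReal.ofReal |K z| := Real.enorm_eq_ofReal_abs _
    _ ≤ ENNReal.ofReal ((|C| + 1) * pnorm z ^ (-3 : ℝ)) := by
        refine ENNReal.ofReal_le_ofReal ((hK z hz).trans ?_)
        gcongr
        · exact Real.rpow_nonneg (pnorm_nonneg z) _
        · linarith [le_abs_self C]
    _ = ENNReal.ofReal (|C| + 1) * ENNReal.ofReal (pnorm z ^ (-3 : ℝ)) :=
        ENNReal.ofReal_mul (by positivity)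
    _ ≤ _ := by gcongr; exact ofReal_pnorm_rpow_le_prod hz

lemma integrable_of_enorm_le_prod {K : (Fin 4 → ℝ) → ℝ} {A : ENNReal} (hA : A ≠ ⊤)
    (hK_cont : ContinuousOn K {(0 : Fin 4 → ℝ)}ᶜ)
    (hK : ∀ z, ‖K z‖ₑ ≤ A * ∏ i, (Set.Icc (-1) 1).indicator singWeight (z i)) :
    Integrable K := by
  have hm : Measurable ((Set.Icc (-1 : ℝ) 1).indicator singWeight) :=
    measurable_singWeight.indicator measurableSet_Icc
  refine ⟨?_, ?_⟩
  · have h := hK_cont.aestronglyMeasurable (μ := volume) (measurableSet_singleton 0).compl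
    rwa [restrict_compl_singleton] at h
  · calc ∫⁻ z, ‖K z‖ₑ
        ≤ ∫⁻ z : Fin 4 → ℝ, A * ∏ i, (Set.Icc (-1) 1).indicator singWeight (z i) :=
          lintegral_mono hK
      _ = A * ∏ _i : Fin 4, ∫⁻ s, (Set.Icc (-1) 1).indicator singWeight s := by
          rw [lintegral_const_mul' _ _ hA, lintegral_fin_prod _ fun _ => hm]
      _ < ⊤ := ENNReal.mul_lt_top hA.lt_top
          (ENNReal.prod_lt_top fun _ _ => lintegral_singWeight_lt_top 1)

lemma lintegral_enorm_stConv_sq_le {K g : (Fin 4 → ℝ) → ℝ} {A B : ENNReal} (hA : A ≠ ⊤)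
    (hB : B ≠ ⊤) (r : Fin 4 → ℝ) (hK : ∀ z, ‖K z‖ₑ ≤ A * ∏ i, singWeight (z i))
    (hg : ∀ z, ‖g z‖ₑ ≤ B * ∏ i, (Set.Icc (-r i) (r i)).indicator 1 (z i)) :
    ∫⁻ z, ‖stConv K g z‖ₑ ^ 2 ≤ (A * B) ^ 2 * ∏ i, ∫⁻ s, boxWeight (r i) s ^ 2 := by
  have hpt (z : Fin 4 → ℝ) : ‖stConv K g z‖ₑ ≤ A * B * ∏ i, boxWeight (r i) (z i) := by
    calc ‖stConv K g z‖ₑ ≤ ∫⁻ w, ‖K (z - w) * g w‖ₑ := enorm_integral_le_lintegral_enorm _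
      _ ≤ ∫⁻ w : Fin 4 → ℝ, A * B *
            ∏ i, singWeight (z i - w i) * (Set.Icc (-r i) (r i)).indicator 1 (w i) := by
          refine lintegral_mono fun w => ?_
          rw [enorm_mul, Finset.prod_mul_distrib, mul_mul_mul_comm]
          exact mul_le_mul' (hK _) (hg _)
      _ = A * B * ∏ i, boxWeight (r i) (z i) := by
          rw [lintegral_const_mul' _ _ (by finiteness),
            lintegral_fin_prod _ fun i => measurable_boxWeight_integrand (r i) (z i)]
          rfl
  calc ∫⁻ z, ‖stConv K g z‖ₑ ^ 2
      ≤ ∫⁻ z : Fin 4 → ℝ, (A * B) ^ 2 * ∏ i, boxWeight (r i) (z i) ^ 2 := by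
        refine lintegral_mono fun z => ?_
        rw [Finset.prod_pow, ← mul_pow]
        exact pow_le_pow_left' (hpt z) 2
    _ = _ := by
        rw [lintegral_const_mul' _ _ (by finiteness),
          lintegral_fin_prod _ fun i => (measurable_boxWeight (r i)).pow_const 2]

lemma IsTestFun.exists_enorm_le {φ : (Fin 4 → ℝ) → ℝ} (hφ : IsTestFun φ) :
    ∃ M R : ℝ, 0 < R ∧
      ∀ z, ‖φ z‖ₑ ≤ ENNReal.ofReal M * ∏ i, (Set.Icc (-R) R).indicator 1 (z i) := by
  obtain ⟨M, hM⟩ := hφ.2.exists_bound_of_continuous hφ.1.continuous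
  obtain ⟨R, hR, hsub⟩ := hφ.2.isCompact.isBounded.subset_closedBall_lt 0 0
  refine ⟨M, R, hR, fun z => ?_⟩
  by_cases hz : z ∈ tsupport φ
  · have hz' : ‖z‖ ≤ R := by simpa using hsub hz
    have hmem (i : Fin 4) : z i ∈ Set.Icc (-R) R := abs_le.1 ((norm_le_pi_norm z i).trans hz')
    simp only [Set.indicator_of_mem (hmem _), Pi.one_apply, Finset.prod_const_one, mul_one]
    rw [← ofReal_norm]
    exact ENNReal.ofReal_le_ofReal (hM z)
  · simp [image_eq_zero_of_notMem_tsupport hz]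

lemma enorm_parRescale_le {φ : (Fin 4 → ℝ) → ℝ} {M R ε : ℝ} (hε : 0 < ε)
    (hφ : ∀ z, ‖φ z‖ₑ ≤ ENNReal.ofReal M * ∏ i, (Set.Icc (-R) R).indicator 1 (z i))
    (z : Fin 4 → ℝ) :
    ‖parRescale ε φ z‖ₑ ≤ ENNReal.ofReal ((ε ^ 5)⁻¹ * M) *
      ∏ i, (Set.Icc (-(R * parScale ε i)) (R * parScale ε i)).indicator 1 (z i) := by
  have hmem (i : Fin 4) : parDilate ε z i ∈ Set.Icc (-R) R ↔
      z i ∈ Set.Icc (-(R * parScale ε i)) (R * parScale ε i) := by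
    have := parScale_pos hε i
    rw [parDilate_apply, Set.mem_Icc, Set.mem_Icc, le_div_iff₀ this, div_le_iff₀ this, neg_mul]
  have h := hφ (parDilate ε z)
  simp only [Set.indicator_apply, hmem] at h
  simp only [Set.indicator_apply]
  rw [parRescale_eq, Pi.smul_apply, smul_eq_mul, enorm_mul,
    Real.enorm_of_nonneg (by positivity : 0 ≤ (ε ^ 5)⁻¹), ENNReal.ofReal_mul (by positivity),
    mul_assoc]
  exact mul_le_mul' le_rfl h

lemma prod_lintegral_boxWeight_sq {R ε : ℝ} (hR : 0 < R) (hε : 0 < ε) :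
    ∏ i, ∫⁻ s, boxWeight (R * parScale ε i) s ^ 2 =
      ENNReal.ofReal ((R ^ 4) ^ (9 / 5 : ℝ) * ε ^ 9) * (∫⁻ s, boxWeight 1 s ^ 2) ^ 4 := by
  have hpos (i : Fin 4) : 0 < R * parScale ε i := mul_pos hR (parScale_pos hε i)
  simp_rw [lintegral_boxWeight_sq (hpos _)]
  rw [Finset.prod_mul_distrib, Finset.prod_const, Finset.card_univ, Fintype.card_fin,
    ← ENNReal.ofReal_prod_of_nonneg fun i _ => Real.rpow_nonneg (hpos i).le _,
    Real.finsetProd_rpow _ _ fun i _ => (hpos i).le]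
  have h : ∏ i, R * parScale ε i = R ^ 4 * ε ^ 5 := by
    simp [Fin.prod_univ_four, parScale]
    ring
  rw [h, Real.mul_rpow (by positivity) (by positivity), ← Real.rpow_natCast ε 5,
    ← Real.rpow_mul hε.le, ← Real.rpow_natCast ε 9]
  norm_num

/-- For every multi-index `q` there is `C` with
`∫ |D^q(K*ρ_ε)(z)|² dz ≤ C·ε^{−1−2|q|}` for all `ε ∈ (0,1)`. -/
theorem stmt_11 (ρ K : (Fin 4 → ℝ) → ℝ)
    (hρ_smooth : ContDiff ℝ (⊤ : ℕ∞) ρ) (hρ_supp : HasCompactSupport ρ)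
    (hρ_int : ∫ z, ρ z = 1)
    (hK_smooth : ContDiffOn ℝ (⊤ : ℕ∞) K {(0 : Fin 4 → ℝ)}ᶜ)
    (hK_supp : ∀ z, 1 < pnorm z → K z = 0)
    (hK_bound : ∀ l : Fin 4 → ℕ, ∃ C : ℝ, ∀ z : Fin 4 → ℝ, z ≠ 0 →
      |Dmulti l K z| ≤ C * pnorm z ^ (-(3 : ℝ) - pdeg l)) :
    ∀ q : Fin 4 → ℕ, ∃ C : ℝ, ∀ ε : ℝ, 0 < ε → ε < 1 →
      (∫ z : Fin 4 → ℝ, (Dmulti q (stConv K (parRescale ε ρ)) z) ^ 2)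
        ≤ C * ε ^ (-(1 : ℝ) - 2 * (pdeg q : ℝ)) := by
  obtain ⟨C, hC⟩ := hK_bound 0
  have hK3 (z : Fin 4 → ℝ) (hz : z ≠ 0) : |K z| ≤ C * pnorm z ^ (-3 : ℝ) := by
    simpa [Dmulti, pdeg] using hC z hz
  have hKb := enorm_kernel_le hK_supp hK3
  have hKw (z : Fin 4 → ℝ) : ‖K z‖ₑ ≤ ENNReal.ofReal (|C| + 1) * ∏ i, singWeight (z i) :=
    (hKb z).trans (mul_le_mul' le_rfl
      (Finset.prod_le_prod' fun i _ => Set.indicator_le_self _ _ _))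
  have hKi : LocallyIntegrable K :=
    (integrable_of_enorm_le_prod ENNReal.ofReal_ne_top hK_smooth.continuousOn hKb).locallyIntegrable
  intro q
  have hρ : IsTestFun ρ := ⟨hρ_smooth, hρ_supp⟩
  obtain ⟨M, R, hR, hM⟩ := (hρ.dmulti q).exists_enorm_le
  set I := ∫⁻ s, boxWeight 1 s ^ 2 with hI
  have hItop : I ≠ ⊤ := lintegral_boxWeight_one_sq_lt_top.ne
  refine ⟨((|C| + 1) * |M|) ^ 2 * ((R ^ 4) ^ (9 / 5 : ℝ) * I.toReal ^ 4), fun ε hε _ => ?_⟩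
  set n := pdeg q with hn
  have hg (z : Fin 4 → ℝ) : ‖Dmulti q (parRescale ε ρ) z‖ₑ ≤
      ENNReal.ofReal ((ε ^ n)⁻¹ * ((ε ^ 5)⁻¹ * |M|)) *
        ∏ i, (Set.Icc (-(R * parScale ε i)) (R * parScale ε i)).indicator 1 (z i) := by
    rw [dmulti_parRescale hρ, Pi.smul_apply, smul_eq_mul, enorm_mul,
      Real.enorm_of_nonneg (by positivity), ENNReal.ofReal_mul (by positivity), mul_assoc]
    refine mul_le_mul' le_rfl ((enorm_parRescale_le hε hM z).trans ?_)
    gcongr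
    exact le_abs_self M
  have key := lintegral_enorm_stConv_sq_le ENNReal.ofReal_ne_top ENNReal.ofReal_ne_top
    (fun i => R * parScale ε i) hKw hg
  rw [← dmulti_stConv hKi (hρ.parRescale hε), prod_lintegral_boxWeight_sq hR hε, ← hI,
    ← ENNReal.ofReal_toReal hItop, ← ENNReal.ofReal_pow ENNReal.toReal_nonneg,
    ← ENNReal.ofReal_mul (by positivity), ← ENNReal.ofReal_mul (by positivity),
    ← ENNReal.ofReal_pow (by positivity), ← ENNReal.ofReal_mul (by positivity)] at key
  have hle := (enorm_integral_le_lintegral_enorm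
    fun z => Dmulti q (stConv K (parRescale ε ρ)) z ^ 2).trans
      ((lintegral_mono fun z => (enorm_pow _ 2).le).trans key)
  rw [← ofReal_norm, ENNReal.ofReal_le_ofReal_iff (by positivity)] at hle
  refine (le_abs_self _).trans (hle.trans_eq ?_)
  have hpow : ε ^ (-(1 : ℝ) - 2 * (n : ℝ)) = (ε ^ (1 + 2 * n))⁻¹ := by
    rw [← Real.rpow_natCast, ← Real.rpow_neg hε.le]
    push_cast
    ring_nf
  rw [hpow]
  field_simp
  ring
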